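/- (Functional equation of the degree-one Estermann function over 𝔽_q[T].) Let g ∈ 𝔽_q[T] be monic and c ∈ 𝔽_q[T]. Then for every u ∈ ℂ with 0 < |u| < 1/q, D_1(u;c/g) = (qu)^{deg g − 1} · Σ_{λ ∈ 𝔽_q^×} [ e_q(λ^{−1}) − 1/(1 − qu) ] · Z(1/(qu); λc, g), where Z(·;λc,g) is evaluated via its rational continuation; equivalently, the identity holds as an equality of rational functions of u. -/

import Mathlib

open Polynomial
open scoped Classical

noncomputable section

/-- The canonical additive character of a finite field `F`:
`e_q(y) = exp(2πi·Tr(y)/p)` where `p` is the characteristic. -/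
def eChar (F : Type) [Field F] [Fintype F] (y : F) : ℂ :=
  letI : Algebra (ZMod (ringChar F)) F := ZMod.algebra F (ringChar F)
  Complex.exp (2 * Real.pi * Complex.I *
    ((Algebra.trace (ZMod (ringChar F)) F y).val : ℂ) / (ringChar F : ℂ))

variable {F : Type} [Field F] [Fintype F]

/-- `e(a/g) = e_q(coefficient of T^(deg g - 1) of (a mod g))`. -/
def eFrac (a g : Polynomial F) : ℂ :=
  eChar F ((a % g).coeff (g.natDegree - 1))

/-- Number of monic divisors of a polynomial. -/
def dCount (f : Polynomial F) : ℕ :=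
  Set.ncard {g : Polynomial F | g.Monic ∧ g ∣ f}

/-- `r_χ(f) = Σ_{g monic, g ∣ f} χ(g)`. -/
def rChi (χ : Polynomial F → ℂ) (f : Polynomial F) : ℂ :=
  ∑ᶠ g ∈ {g : Polynomial F | g.Monic ∧ g ∣ f}, χ g

/-- A Dirichlet character modulo `ℓ`: a function induced by a group homomorphism
`(F[T]/(ℓ))^× → ℂ^×`, extended by zero on non-coprime arguments. -/
def IsDirichletChar (ℓ : Polynomial F) (χ : Polynomial F → ℂ) : Prop :=
  (∀ f g : Polynomial F, f % ℓ = g % ℓ → χ f = χ g) ∧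
  (∀ f g : Polynomial F, χ (f * g) = χ f * χ g) ∧ χ 1 = 1 ∧
  ∀ f : Polynomial F, χ f = 0 ↔ ¬ IsCoprime f ℓ

/-- Primitivity: `χ` is not induced by a character modulo a proper (monic) divisor of `ℓ`. -/
def IsPrimitiveChar (ℓ : Polynomial F) (χ : Polynomial F → ℂ) : Prop :=
  IsDirichletChar ℓ χ ∧
  ∀ ℓ' : Polynomial F, ℓ'.Monic → ℓ' ∣ ℓ → ℓ' ≠ ℓ →
    ¬ ∃ χ' : Polynomial F → ℂ, IsDirichletChar ℓ' χ' ∧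
      ∀ f : Polynomial F, IsCoprime f ℓ → χ f = χ' f

/-- Complex conjugate character. -/
def conjChar (χ : Polynomial F → ℂ) : Polynomial F → ℂ := fun f => starRingEnd ℂ (χ f)

/-- `L(s,χ) = Σ_{f monic} χ(f)|f|^{-s}`, summed by degree. -/
def LFun (χ : Polynomial F → ℂ) (s : ℂ) : ℂ :=
  ∑' n : ℕ, (∑ᶠ f ∈ {f : Polynomial F | f.Monic ∧ f.natDegree = n}, χ f) *
    (Fintype.card F : ℂ) ^ (-(s * (n : ℂ)))

/-- Gauss sum `G(χ) = Σ_{deg a < deg ℓ} χ(a)·e(a/ℓ)`. -/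
def GSum (ℓ : Polynomial F) (χ : Polynomial F → ℂ) : ℂ :=
  ∑ᶠ a ∈ {a : Polynomial F | a.degree < ℓ.degree}, χ a * eFrac a ℓ

/-- Kloosterman sum over `F`. -/
def Kl2 (α β : F) : ℂ :=
  ∑ γ : Fˣ, eChar F (α * (γ : F) + β * ((γ⁻¹ : Fˣ) : F))

/-- Twisted Kloosterman sum over `F`. -/
def KlChi (χ : Polynomial F → ℂ) (α β : F) : ℂ :=
  ∑ γ : Fˣ, χ (Polynomial.C (γ : F)) * eChar F (α * (γ : F) + β * ((γ⁻¹ : Fˣ) : F))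

/-- Gauss sum of the restriction of `χ` to `F`. -/
def tauChi (χ : Polynomial F → ℂ) (α : F) : ℂ :=
  ∑ γ : Fˣ, χ (Polynomial.C (γ : F)) * eChar F (α * (γ : F))

/-- Generalized binomial coefficient `C(-m, j)`. -/
def negBinom (m j : ℕ) : ℤ :=
  if m = 0 then (if j = 0 then 1 else 0) else (-1) ^ j * (Nat.choose (m + j - 1) j)

/-- The coefficients `b_k(χ; λ, η₁, η₂)` of the Voronoi summation formula. -/
def bCoeff (χ : Polynomial F → ℂ) (lam : F) (η₁ η₂ k : ℕ) : ℂ :=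
  (-1 : ℂ) ^ (k - η₁ - η₂) * KlChi χ ((η₁ : F) - 1) ((1 - (η₂ : F)) * lam) *
    (if η₁ + η₂ ≤ k then (negBinom (η₁ + η₂) (k - η₁ - η₂) : ℂ) else 0)

/-- The untwisted coefficients `b_k(λ, η₁, η₂)`. -/
def bCoeffD (lam : F) (η₁ η₂ k : ℕ) : ℂ :=
  (-1 : ℂ) ^ (k - η₁ - η₂) * Kl2 ((η₁ : F) - 1) ((1 - (η₂ : F)) * lam) *
    (if η₁ + η₂ ≤ k then (negBinom (η₁ + η₂) (k - η₁ - η₂) : ℂ) else 0)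

/-- The series `Σ_{f monic} c(f)·u^{deg f}` (as a `tsum`). -/
def monicSeries (c : Polynomial F → ℂ) (u : ℂ) : ℂ :=
  ∑' f : {f : Polynomial F // f.Monic}, c f * u ^ (f : Polynomial F).natDegree

/-- `φ` is the rational continuation of the series `u ↦ Σ_{f monic} c(f)·u^{deg f}`:
it agrees with the (convergent) series on `‖u‖ < 1/q` and is a rational function. -/
def IsRatCont (c : Polynomial F → ℂ) (φ : ℂ → ℂ) : Prop :=
  (∃ P Q : Polynomial ℂ, IsCoprime P Q ∧ Q ≠ 0 ∧
    ∀ z : ℂ, Q.eval z ≠ 0 → φ z = P.eval z / Q.eval z) ∧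
  ∀ u : ℂ, ‖u‖ < 1 / (Fintype.card F) →
    HasSum (fun f : {f : Polynomial F // f.Monic} => c f * u ^ (f : Polynomial F).natDegree)
      (φ u)

end

section AdditiveCharacter

variable (F : Type) [Field F] [Fintype F]

/-- `eChar F` is a nontrivial additive character of `F`. -/
theorem exists_addChar_eq_eChar : ∃ ψ : AddChar F ℂ, ψ ≠ 1 ∧ ∀ y, ψ y = eChar F y := by
  let _ : Algebra (ZMod (ringChar F)) F := ZMod.algebra F (ringChar F)
  have : NeZero (ringChar F) := ⟨CharP.ringChar_ne_zero_of_finite F⟩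
  refine ⟨(ZMod.stdAddChar (N := ringChar F)).compAddMonoidHom
    (Algebra.trace (ZMod (ringChar F)) F).toAddMonoidHom, fun h => ?_, fun y => ?_⟩
  · obtain ⟨b, hb⟩ := FiniteField.trace_to_zmod_nondegenerate F (one_ne_zero (α := F))
    apply hb
    apply ZMod.injective_stdAddChar
    simpa using DFunLike.congr_fun h (1 * b)
  · simp only [AddChar.compAddMonoidHom_apply, ZMod.stdAddChar_apply, ZMod.toCircle_apply, eChar]
    rfl

theorem eChar_zero : eChar F 0 = 1 := by
  obtain ⟨ψ, -, h⟩ := exists_addChar_eq_eChar F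
  rw [← h, AddChar.map_zero_eq_one]

theorem eChar_add (x y : F) : eChar F (x + y) = eChar F x * eChar F y := by
  obtain ⟨ψ, -, h⟩ := exists_addChar_eq_eChar F
  rw [← h, ← h, ← h, AddChar.map_add_eq_mul]

theorem norm_eChar (x : F) : ‖eChar F x‖ = 1 := by
  obtain ⟨ψ, -, h⟩ := exists_addChar_eq_eChar F
  rw [← h, AddChar.norm_apply]

theorem exists_eChar_ne_one : ∃ y, eChar F y ≠ 1 := by
  obtain ⟨ψ, hψ, h⟩ := exists_addChar_eq_eChar F
  obtain ⟨y, hy⟩ := AddChar.ne_one_iff.mp hψ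
  exact ⟨y, h y ▸ hy⟩

theorem sum_units_eChar_inv : ∑ lam : Fˣ, eChar F ((lam⁻¹ : Fˣ) : F) = -1 := by
  obtain ⟨ψ, hψ, h⟩ := exists_addChar_eq_eChar F
  have h0 : ∑ y, eChar F y = 0 := by
    simpa only [h] using AddChar.sum_eq_zero_of_ne_one hψ
  refine (Equiv.sum_comp (Equiv.inv Fˣ) fun lam : Fˣ => eChar F (lam : F)).trans ?_
  rw [Fintype.sum_eq_add_sum_subtype_ne _ 0, eChar_zero,
    ← Equiv.sum_comp (unitsEquivNeZero (G₀ := F))] at h0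
  exact eq_neg_of_add_eq_zero_right h0

end AdditiveCharacter

section MonicSums

variable {F : Type} [Field F] [Fintype F]

theorem card_monic_natDegree_eq (n : ℕ) :
    Nat.card {f : {f : F[X] // f.Monic} // (f : F[X]).natDegree = n} = Fintype.card F ^ n := by
  rw [Nat.card_congr (((Equiv.subtypeSubtypeEquivSubtypeInter (fun f : F[X] => f.Monic)
    (fun f => f.natDegree = n)).trans (Polynomial.monicEquivDegreeLT n)).trans
    (Polynomial.degreeLTEquiv F n).toEquiv)]
  simp

theorem hasSum_monic_natDegree {b : ℕ → ℂ}
    (hb : Summable fun n => ‖(Fintype.card F : ℂ) ^ n * b n‖) :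
    HasSum (fun f : {f : F[X] // f.Monic} => b (f : F[X]).natDegree)
      (∑' n, (Fintype.card F : ℂ) ^ n * b n) := by
  let e := Equiv.sigmaFiberEquiv fun f : {f : F[X] // f.Monic} => (f : F[X]).natDegree
  have hfin (n : ℕ) : Finite {f : {f : F[X] // f.Monic} // (f : F[X]).natDegree = n} :=
    Nat.finite_of_card_ne_zero (by rw [card_monic_natDegree_eq]; positivity)
  have hfib (n : ℕ) {E : Type} [NormedRing E] (x : E) :
      HasSum (fun _ : {f : {f : F[X] // f.Monic} // (f : F[X]).natDegree = n} => x)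
        ((Fintype.card F : E) ^ n * x) := by
    have : Fintype _ := Fintype.ofFinite {f : {f : F[X] // f.Monic} // (f : F[X]).natDegree = n}
    convert hasSum_fintype (fun _ : {f : {f : F[X] // f.Monic} // (f : F[X]).natDegree = n} => x)
    have hcard := card_monic_natDegree_eq (F := F) n
    rw [Nat.card_eq_fintype_card] at hcard
    rw [Finset.sum_const, Finset.card_univ, hcard, nsmul_eq_mul, Nat.cast_pow]
  have heq (x) : b (e x : F[X]).natDegree = b x.1 := by
    obtain ⟨n, f, hf⟩ := x
    exact congrArg b hf
  have hs : Summable fun x => b (e x : F[X]).natDegree := by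
    simp_rw [heq]
    refine Summable.of_norm ((summable_sigma_of_nonneg fun _ => norm_nonneg _).mpr
      ⟨fun n => (hfib n ‖b n‖).summable, ?_⟩)
    refine hb.congr fun n => ?_
    rw [(hfib n ‖b n‖).tsum_eq]
    simp
  rw [← e.hasSum_iff]
  have h2 := hs.hasSum.sigma (g := fun n => (Fintype.card F : ℂ) ^ n * b n) fun n => by
    simpa only [heq] using hfib n (b n)
  rw [h2.tsum_eq]
  exact hs.hasSum

theorem norm_card_mul_lt_one {u : ℂ} (hu : ‖u‖ < 1 / (Fintype.card F : ℝ)) :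
    ‖(Fintype.card F : ℂ) * u‖ < 1 := by
  have hq : 0 < (Fintype.card F : ℝ) := by exact_mod_cast Fintype.card_pos
  rw [lt_div_iff₀ hq] at hu
  simpa [mul_comm] using hu

theorem hasSum_monic_pow {u : ℂ} (hu : ‖u‖ < 1 / (Fintype.card F : ℝ)) :
    HasSum (fun f : {f : F[X] // f.Monic} => u ^ (f : F[X]).natDegree)
      (1 / (1 - (Fintype.card F : ℂ) * u)) := by
  have h1 := norm_card_mul_lt_one (F := F) hu
  have := hasSum_monic_natDegree (F := F) (b := fun n => u ^ n)
    (by simpa only [← mul_pow, norm_pow] using summable_geometric_of_lt_one (norm_nonneg _) h1)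
  simpa only [← mul_pow, tsum_geometric_of_norm_lt_one h1, one_div] using this

theorem summable_mul_monic_pow {u : ℂ} (hu : ‖u‖ < 1 / (Fintype.card F : ℝ)) {a : F[X] → ℂ}
    (ha : ∀ f, ‖a f‖ ≤ 1) :
    Summable fun f : {f : F[X] // f.Monic} => a f * u ^ (f : F[X]).natDegree := by
  refine (hasSum_monic_pow hu).summable.norm.of_norm_bounded fun f => ?_
  rw [norm_mul]
  exact mul_le_of_le_one_left (norm_nonneg _) (ha f)

/-- The monic polynomials congruent to a reduced residue `s` modulo `g` are `s` itself, if it is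
monic, and `g * h + s` with `h` monic. -/
theorem hasSum_monic_residue {g : F[X]} (hg : g.Monic) {s : F[X]} (hs : s.degree < g.degree)
    {u : ℂ} (hu : ‖u‖ < 1 / (Fintype.card F : ℝ)) :
    HasSum (fun f : {f : F[X] // f.Monic} =>
        (if (f : F[X]) % g = s then (1 : ℂ) else 0) * u ^ (f : F[X]).natDegree)
      ((if s.Monic then u ^ s.natDegree else 0) +
        u ^ g.natDegree / (1 - (Fintype.card F : ℂ) * u)) := by
  have hsg : s % g = s := (Polynomial.mod_eq_self_iff hg.ne_zero).mpr hs
  have hlow : HasSum (fun f : {f : F[X] // f.Monic} =>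
      if (f : F[X]) = s then u ^ (f : F[X]).natDegree else 0)
      (if s.Monic then u ^ s.natDegree else 0) := by
    split_ifs with hm
    · convert hasSum_ite_eq (⟨s, hm⟩ : {f : F[X] // f.Monic}) (u ^ s.natDegree) using 2 with f
      by_cases h : (f : F[X]) = s
      · simp [h, Subtype.ext_iff]
      · simp [h, Subtype.ext_iff]
    · convert (hasSum_zero : HasSum (fun _ : {f : F[X] // f.Monic} => (0 : ℂ)) 0) using 2 with f
      exact if_neg fun h : (f : F[X]) = s => hm (h ▸ f.2)
  have hlt (h : F[X]) (hh : h ≠ 0) : s.degree < (g * h).degree := by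
    exact hs.trans_le (Polynomial.degree_le_mul_left g hh)
  let i : {h : F[X] // h.Monic} → {f : F[X] // f.Monic} := fun h =>
    ⟨g * h + s, (hg.mul h.2).add_of_left (hlt h h.2.ne_zero)⟩
  have hi : Function.Injective i := fun h h' hh => by
    have := congrArg Subtype.val hh
    exact Subtype.ext (mul_left_cancel₀ hg.ne_zero (add_right_cancel this))
  have hhigh : HasSum (fun f : {f : F[X] // f.Monic} =>
      if (f : F[X]) % g = s ∧ (f : F[X]) ≠ s then u ^ (f : F[X]).natDegree else 0)
      (u ^ g.natDegree / (1 - (Fintype.card F : ℂ) * u)) := by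
    rw [← hi.hasSum_iff]
    · rw [← mul_one_div]
      refine (congrArg (HasSum · _) (funext fun h => ?_)).mp
        ((hasSum_monic_pow hu).mul_left (u ^ g.natDegree))
      have h1 : (g * (h : F[X]) + s) % g = s := by
        rw [Polynomial.add_mod, EuclideanDomain.mod_eq_zero.mpr (dvd_mul_right _ _), zero_add,
          hsg]
      have h2 : g * (h : F[X]) + s ≠ s := by
        simpa using ⟨hg.ne_zero, h.2.ne_zero⟩
      have h3 : (g * (h : F[X]) + s).natDegree = g.natDegree + (h : F[X]).natDegree := by
        rw [Polynomial.natDegree_add_eq_left_of_degree_lt (hlt h h.2.ne_zero), hg.natDegree_mul h.2]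
      simp only [Function.comp_apply, i, h1, h2, h3, ne_eq, not_false_eq_true, and_self, if_true,
        pow_add]
    · rintro f hf
      refine if_neg ?_
      rintro ⟨h1, h2⟩
      apply hf
      have h3 := EuclideanDomain.mod_add_div (f : F[X]) g
      rw [h1, add_comm] at h3
      have h4 : ((f : F[X]) / g).Monic := by
        have h5 : (f : F[X]) / g ≠ 0 := fun h0 => h2 (by rw [← h3, h0, mul_zero, zero_add])
        refine hg.of_mul_monic_left ?_
        rw [Polynomial.Monic, ← Polynomial.leadingCoeff_add_of_degree_lt' (hlt _ h5), h3]
        exact f.2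
      exact ⟨⟨_, h4⟩, Subtype.ext h3⟩
  convert hlow.add hhigh using 2 with f
  by_cases h : (f : F[X]) = s
  · simp [h, hsg]
  · simp [h]

end MonicSums

/-- A rational continuation takes the expected value wherever an explicit fraction for it is
defined. -/
theorem IsRatCont.eq_div {F : Type} [Field F] [Fintype F] {a : F[X] → ℂ} {φ : ℂ → ℂ}
    (hφ : IsRatCont a φ) {N D : ℂ[X]}
    (h : ∀ z : ℂ, ‖z‖ < 1 / (Fintype.card F : ℝ) → φ z * D.eval z = N.eval z)
    {w : ℂ} (hw : D.eval w ≠ 0) : φ w = N.eval w / D.eval w := by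
  obtain ⟨⟨P, Q, hPQ, hQ, hφ⟩, -⟩ := hφ
  have hball : (Metric.ball (0 : ℂ) (1 / (Fintype.card F : ℝ))).Infinite :=
    infinite_of_mem_nhds 0 (Metric.ball_mem_nhds 0 (by positivity))
  have hcross : P * D = N * Q := by
    refine mul_right_cancel₀ hQ (Polynomial.eq_of_infinite_eval_eq _ _ (hball.mono fun z hz => ?_))
    simp only [Set.mem_ofPred_eq, Polynomial.eval_mul]
    by_cases hz0 : Q.eval z = 0
    · simp [hz0]
    · rw [← h z (mem_ball_zero_iff.mp hz), hφ z hz0]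
      field_simp
  have hcross_w : P.eval w * D.eval w = N.eval w * Q.eval w := by
    simpa using congrArg (Polynomial.eval w) hcross
  have hQw : Q.eval w ≠ 0 := fun h0 => by
    have hPw : P.eval w = 0 := by simpa [h0, hw] using hcross_w
    obtain ⟨A, B, hAB⟩ := hPQ
    simpa [hPw, h0] using congrArg (Polynomial.eval w) hAB
  rw [hφ w hQw, div_eq_div_iff hQw hw, hcross_w]

theorem ratCont_monic_residue_eq {F : Type} [Field F] [Fintype F] {g : F[X]} (hg : g.Monic)
    {s : F[X]} (hs : s.degree < g.degree) {φ : ℂ → ℂ}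
    (hφ : IsRatCont (fun f => if f % g = s then (1 : ℂ) else 0) φ)
    {w : ℂ} (hw : 1 - (Fintype.card F : ℂ) * w ≠ 0) :
    φ w = (if s.Monic then w ^ s.natDegree else 0) +
      w ^ g.natDegree / (1 - (Fintype.card F : ℂ) * w) := by
  let D : ℂ[X] := 1 - C (Fintype.card F : ℂ) * X
  let N : ℂ[X] := (if s.Monic then X ^ s.natDegree else 0) * D + X ^ g.natDegree
  have hD (z : ℂ) : D.eval z = 1 - (Fintype.card F : ℂ) * z := by simp [D]
  have hN (z : ℂ) : N.eval z = (if s.Monic then z ^ s.natDegree else 0) *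
      (1 - (Fintype.card F : ℂ) * z) + z ^ g.natDegree := by
    simp only [N, Polynomial.eval_add, Polynomial.eval_mul, hD, Polynomial.eval_pow,
      Polynomial.eval_X]
    split_ifs <;> simp
  rw [hφ.eq_div (N := N) (D := D) (fun z hz => ?_) (by rwa [hD]), hD, hN, add_div,
    mul_div_cancel_right₀ _ hw]
  have hz0 : 1 - (Fintype.card F : ℂ) * z ≠ 0 := fun h0 => by
    have := norm_card_mul_lt_one (F := F) hz
    rw [← sub_eq_zero.mp h0] at this
    simp at this
  rw [(hφ.2 z hz).unique (hasSum_monic_residue hg hs hz), hD, hN, add_mul, div_mul_cancel₀ _ hz0]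

section EstermannSeries

variable {F : Type} [Field F] [Fintype F]

theorem norm_eFrac (a g : F[X]) : ‖eFrac a g‖ = 1 := norm_eChar F _

theorem Polynomial.mod_mod_self {K : Type*} [Field K] (a g : K[X]) : a % g % g = a % g := by
  rw [← sub_eq_zero, ← Polynomial.sub_mod, EuclideanDomain.mod_eq_zero,
    EuclideanDomain.mod_eq_sub_mul_div, sub_sub_cancel_left, dvd_neg]
  exact dvd_mul_right _ _

theorem eFrac_mod (a g : F[X]) : eFrac (a % g) g = eFrac a g := by
  rw [eFrac, Polynomial.mod_mod_self, eFrac]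

theorem eFrac_add (a b g : F[X]) : eFrac (a + b) g = eFrac a g * eFrac b g := by
  rw [eFrac, Polynomial.add_mod, Polynomial.coeff_add, eChar_add, eFrac, eFrac]

theorem eFrac_mod_mul (c f g : F[X]) : eFrac (c % g * f) g = eFrac (c * f) g := by
  rw [← eFrac_mod, ← eFrac_mod (c * f), Polynomial.mul_mod, Polynomial.mod_mod_self,
    ← Polynomial.mul_mod]

theorem eFrac_of_degree_lt {a g : F[X]} (hg : g ≠ 0) (h : a.degree < g.degree) :
    eFrac a g = eChar F (a.coeff (g.natDegree - 1)) := by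
  rw [eFrac, (Polynomial.mod_eq_self_iff hg).mpr h]

theorem eFrac_mul_of_natDegree_lt {r f g : F[X]}
    (h : r.natDegree + f.natDegree + 1 < g.natDegree) : eFrac (r * f) g = 1 := by
  have h1 := Polynomial.natDegree_mul_le (p := r) (q := f)
  rw [eFrac_of_degree_lt (by rintro rfl; simp at h)
    (Polynomial.degree_lt_degree (by omega)),
    Polynomial.coeff_eq_zero_of_natDegree_lt (by omega), eChar_zero]

theorem eFrac_mul_of_natDegree_eq {r f g : F[X]}
    (h : r.natDegree + f.natDegree + 1 = g.natDegree) :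
    eFrac (r * f) g = eChar F (r.leadingCoeff * f.leadingCoeff) := by
  have h1 := Polynomial.natDegree_mul_le (p := r) (q := f)
  rw [eFrac_of_degree_lt (by rintro rfl; simp at h)
    (Polynomial.degree_lt_degree (by omega)), ← h, Nat.add_sub_cancel,
    Polynomial.coeff_mul_degree_add_degree]

/-- Translating by a multiple of `X ^ k` shows that the part of the series supported in degrees
above `k` vanishes. -/
theorem tsum_eFrac_of_lt_natDegree {r g : F[X]} (hr : r ≠ 0) {k : ℕ}
    (hk : r.natDegree + k + 1 = g.natDegree) (u : ℂ) :
    ∑' f : {f : F[X] // f.Monic},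
      (if k < (f : F[X]).natDegree then eFrac (r * (f : F[X])) g * u ^ (f : F[X]).natDegree
        else 0) = 0 := by
  obtain ⟨y, hy⟩ := exists_eChar_ne_one F
  set b := r.leadingCoeff⁻¹ * y
  have hy0 : y ≠ 0 := by
    rintro rfl
    exact hy (eChar_zero F)
  have hr0 : r.leadingCoeff ≠ 0 := Polynomial.leadingCoeff_ne_zero.mpr hr
  have hb : b ≠ 0 := mul_ne_zero (inv_ne_zero hr0) hy0
  have hdeg (b : F) : (C b * X ^ k).natDegree ≤ k := Polynomial.natDegree_C_mul_X_pow_le b k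
  have htrans (b : F) (f : F[X]) (hf : k < f.natDegree) :
      (f + C b * X ^ k).natDegree = f.natDegree :=
    Polynomial.natDegree_add_eq_left_of_natDegree_lt ((hdeg b).trans_lt hf)
  have hmonic (b : F) (f : F[X]) (hf : f.Monic) (h : k < f.natDegree) : (f + C b * X ^ k).Monic :=
    hf.add_of_left (Polynomial.degree_lt_degree ((hdeg b).trans_lt h))
  let τ (b : F) (f : {f : F[X] // f.Monic}) : {f : F[X] // f.Monic} :=
    if h : k < (f : F[X]).natDegree then ⟨(f : F[X]) + C b * X ^ k, hmonic b f f.2 h⟩ else f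
  have hτ (b : F) (f : {f : F[X] // f.Monic}) (h : k < (f : F[X]).natDegree) :
      (τ b f : F[X]) = (f : F[X]) + C b * X ^ k := by
    simp [τ, h]
  have hτ' (b : F) (f : {f : F[X] // f.Monic}) (h : ¬ k < (f : F[X]).natDegree) : τ b f = f := by
    simp [τ, h]
  have hinv (b : F) : Function.LeftInverse (τ (-b)) (τ b) := fun f => by
    by_cases h : k < (f : F[X]).natDegree
    · apply Subtype.ext
      rw [hτ _ _ (by rwa [hτ b f h, htrans b f h]), hτ b f h]
      simp
    · rw [hτ' b f h, hτ' _ f h]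
  let e : {f : F[X] // f.Monic} ≃ {f : F[X] // f.Monic} :=
    ⟨τ b, τ (-b), hinv b, by simpa using (hinv (-b)).rightInverse⟩
  have hshift : eFrac (r * (C b * X ^ k)) g = eChar F y := by
    rw [eFrac_mul_of_natDegree_eq (by rwa [Polynomial.natDegree_C_mul_X_pow k b hb]),
      Polynomial.leadingCoeff_C_mul_X_pow, mul_inv_cancel_left₀ hr0]
  have key := e.tsum_eq fun f : {f : F[X] // f.Monic} =>
    if k < (f : F[X]).natDegree then eFrac (r * (f : F[X])) g * u ^ (f : F[X]).natDegree else 0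
  have hmul (f : {f : F[X] // f.Monic}) :
      (if k < (e f : F[X]).natDegree then eFrac (r * (e f : F[X])) g * u ^ (e f : F[X]).natDegree
        else 0) =
        eChar F y *
          (if k < (f : F[X]).natDegree then eFrac (r * (f : F[X])) g * u ^ (f : F[X]).natDegree
            else 0) := by
    change (if k < (τ b f : F[X]).natDegree then
      eFrac (r * (τ b f : F[X])) g * u ^ (τ b f : F[X]).natDegree else 0) = _
    by_cases h : k < (f : F[X]).natDegree
    · rw [hτ b f h, htrans b f h, if_pos h, if_pos h, mul_add, eFrac_add, hshift]
      ring
    · rw [hτ' b f h, if_neg h, mul_zero]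
  simp_rw [hmul, tsum_mul_left] at key
  by_contra h0
  exact hy (mul_right_cancel₀ h0 (key.trans (one_mul _).symm))

theorem monicSeries_eFrac_of_mod_ne_zero {c g : F[X]} (hr : c % g ≠ 0) {k : ℕ}
    (hk : (c % g).natDegree + k + 1 = g.natDegree) {u : ℂ}
    (hu : ‖u‖ < 1 / (Fintype.card F : ℝ)) :
    monicSeries (fun f => eFrac (c * f) g) u =
      (1 - ((Fintype.card F : ℂ) * u) ^ k) / (1 - (Fintype.card F : ℂ) * u) +
        ((Fintype.card F : ℂ) * u) ^ k * eChar F (c % g).leadingCoeff := by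
  set r := c % g
  let b : ℕ → ℂ := fun n =>
    if n < k then u ^ n else if n = k then eChar F r.leadingCoeff * u ^ n else 0
  have hb0 : ∀ n ∉ Finset.range (k + 1), (Fintype.card F : ℂ) ^ n * b n = 0 := fun n hn => by
    have : k < n := by simpa using hn
    simp [b, this.ne', this.not_gt]
  have hlow := hasSum_monic_natDegree (F := F) (b := b)
    (summable_of_ne_finset_zero (s := Finset.range (k + 1)) fun n hn => by rw [hb0 n hn, norm_zero])
  have hsum : ∑' n, (Fintype.card F : ℂ) ^ n * b n =
      (1 - ((Fintype.card F : ℂ) * u) ^ k) / (1 - (Fintype.card F : ℂ) * u) +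
        ((Fintype.card F : ℂ) * u) ^ k * eChar F r.leadingCoeff := by
    have h1 : (Fintype.card F : ℂ) * u ≠ 1 := fun h => by
      simpa [h] using norm_card_mul_lt_one (F := F) hu
    rw [tsum_eq_sum hb0, Finset.sum_range_succ,
      Finset.sum_congr rfl fun n hn => by
        rw [show b n = u ^ n from if_pos (Finset.mem_range.mp hn), ← mul_pow],
      geom_sum_eq h1, ← neg_div_neg_eq, neg_sub, neg_sub]
    simp only [b, lt_irrefl, if_false, if_true, mul_pow]
    ring
  have hall := summable_mul_monic_pow hu (a := fun f => eFrac (r * f) g) fun f =>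
    (norm_eFrac _ _).le
  have hsplit (f : {f : F[X] // f.Monic}) :
      eFrac (c * (f : F[X])) g * u ^ (f : F[X]).natDegree = b (f : F[X]).natDegree +
        if k < (f : F[X]).natDegree then eFrac (r * (f : F[X])) g * u ^ (f : F[X]).natDegree else 0 := by
    rw [show eFrac (c * (f : F[X])) g = eFrac (r * (f : F[X])) g from (eFrac_mod_mul ..).symm]
    rcases lt_trichotomy (f : F[X]).natDegree k with h | h | h
    · rw [eFrac_mul_of_natDegree_lt (by omega)]
      simp [b, h, h.not_gt]
    · rw [eFrac_mul_of_natDegree_eq (by omega), f.2.leadingCoeff]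
      simp [b, h, r]
    · simp [b, h, h.ne', h.not_gt, r]
  have hhigh : Summable fun f : {f : F[X] // f.Monic} =>
      if k < (f : F[X]).natDegree then eFrac (r * (f : F[X])) g * u ^ (f : F[X]).natDegree else 0 :=
    (hall.indicator {f | k < (f : F[X]).natDegree}).congr fun f => by simp [Set.indicator_apply]
  rw [monicSeries, tsum_congr hsplit, hlow.summable.tsum_add hhigh, hlow.tsum_eq, hsum,
    tsum_eFrac_of_lt_natDegree hr hk, add_zero]

theorem monicSeries_eFrac_of_mod_eq_zero {c g : F[X]} (hr : c % g = 0) {u : ℂ}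
    (hu : ‖u‖ < 1 / (Fintype.card F : ℝ)) :
    monicSeries (fun f => eFrac (c * f) g) u = 1 / (1 - (Fintype.card F : ℂ) * u) := by
  rw [monicSeries, ← (hasSum_monic_pow hu).tsum_eq]
  refine tsum_congr fun f => ?_
  rw [← eFrac_mod_mul, hr, zero_mul, eFrac, EuclideanDomain.zero_mod, Polynomial.coeff_zero,
    eChar_zero, one_mul]

end EstermannSeries

/-- **Functional equation of the degree-one Estermann function over `𝔽_q[T]`:**
for `0 < |u| < 1/q`,
`D_1(u;c/g) = (qu)^{deg g - 1} Σ_{λ ∈ F^×} [e_q(λ⁻¹) - 1/(1-qu)]·Z(1/(qu); λc, g)`,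
where `Z` is evaluated via its rational continuation. -/
theorem estermannD1_functional_equation
    (F : Type) [Field F] [Fintype F] (q : ℕ) (hq : q = Fintype.card F)
    (g : Polynomial F) (hg : g.Monic) (c : Polynomial F)
    (φZ : Fˣ → ℂ → ℂ)
    (hφZ : ∀ lam : Fˣ,
      IsRatCont
        (fun f => if f % g = (Polynomial.C (lam : F) * c) % g then (1 : ℂ) else 0)
        (φZ lam))
    (u : ℂ) (hu0 : 0 < ‖u‖) (hu : ‖u‖ < 1 / q) :
    monicSeries (fun f => eFrac (c * f) g) u =
      ((q : ℂ) * u) ^ ((g.natDegree : ℤ) - 1) *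
        ∑ lam : Fˣ,
          (eChar F (((lam⁻¹ : Fˣ) : F)) - 1 / (1 - (q : ℂ) * u)) *
            φZ lam (1 / ((q : ℂ) * u)) := by

  subst hq
  have hu0' : u ≠ 0 := norm_pos_iff.mp hu0
  have hq0 : (Fintype.card F : ℂ) ≠ 0 := by exact_mod_cast Fintype.card_ne_zero
  have hx0 : (Fintype.card F : ℂ) * u ≠ 0 := mul_ne_zero hq0 hu0'
  have hx1 : 1 - (Fintype.card F : ℂ) * u ≠ 0 := fun h => by
    simpa [← sub_eq_zero.mp h] using norm_card_mul_lt_one (F := F) hu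
  have hu1 : u - 1 ≠ 0 := fun h => by
    rw [sub_eq_zero.mp h, norm_one, lt_div_iff₀ (by positivity), one_mul] at hu
    exact hu.not_ge (by exact_mod_cast Fintype.card_pos)
  have hw : 1 - (Fintype.card F : ℂ) * (1 / ((Fintype.card F : ℂ) * u)) = (u - 1) / u := by
    field_simp
  have hres (lam : Fˣ) : (C (lam : F) * c) % g = C (lam : F) * (c % g) := by
    rw [← Polynomial.modByMonic_eq_mod _ hg, ← Polynomial.modByMonic_eq_mod _ hg,
      ← Polynomial.smul_eq_C_mul, ← Polynomial.smul_eq_C_mul, Polynomial.smul_modByMonic]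
  have hdeg (lam : Fˣ) : (C (lam : F) * (c % g)).natDegree = (c % g).natDegree :=
    Polynomial.natDegree_C_mul lam.ne_zero
  have hZ (lam : Fˣ) := by
    have h := hφZ lam
    rw [hres] at h
    exact ratCont_monic_residue_eq hg
      (by rw [← hres]; exact Polynomial.degree_mod_lt _ hg.ne_zero) h
      (w := 1 / ((Fintype.card F : ℂ) * u)) (by rw [hw]; exact div_ne_zero hu1 hu0')
  have hcard : (Fintype.card Fˣ : ℂ) = Fintype.card F - 1 := by
    rw [Fintype.card_units, Nat.cast_sub Fintype.card_pos, Nat.cast_one]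
  have hconst : ∑ lam : Fˣ, (eChar F ((lam⁻¹ : Fˣ) : F) - 1 / (1 - (Fintype.card F : ℂ) * u)) =
      -((Fintype.card F : ℂ) * (1 - u) / (1 - (Fintype.card F : ℂ) * u)) := by
    rw [Finset.sum_sub_distrib, sum_units_eChar_inv, Finset.sum_const, Finset.card_univ,
      nsmul_eq_mul, hcard]
    field_simp
    ring
  simp_rw [hZ, hdeg, hw, mul_add, Finset.sum_add_distrib]
  rw [← Finset.sum_mul, hconst, zpow_sub_one₀ hx0, zpow_natCast]
  by_cases hr : c % g = 0
  · rw [monicSeries_eFrac_of_mod_eq_zero hr hu]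
    simp only [hr, mul_zero, Polynomial.not_monic_zero, if_false, Finset.sum_const_zero, zero_add]
    rw [one_div_pow]
    have := pow_ne_zero g.natDegree hx0
    field_simp
    ring
  · have hr0 : (c % g).leadingCoeff ≠ 0 := Polynomial.leadingCoeff_ne_zero.mpr hr
    have hmonic (lam : Fˣ) : (C (lam : F) * (c % g)).Monic ↔ lam = (Units.mk0 _ hr0)⁻¹ := by
      rw [Polynomial.Monic, Polynomial.leadingCoeff_mul, Polynomial.leadingCoeff_C,
        eq_inv_iff_mul_eq_one, Units.ext_iff]
      simp
    obtain ⟨k, hk⟩ : ∃ k, (c % g).natDegree + k + 1 = g.natDegree := by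
      have := Polynomial.natDegree_lt_natDegree hr (Polynomial.degree_mod_lt c hg.ne_zero)
      exact ⟨g.natDegree - (c % g).natDegree - 1, by omega⟩
    rw [monicSeries_eFrac_of_mod_ne_zero hr hk hu]
    simp only [hmonic, mul_ite, mul_zero, Finset.sum_ite_eq', Finset.mem_univ, if_true, inv_inv,
      Units.val_mk0, ← hk, one_div_pow, pow_add, pow_one]
    have := pow_ne_zero (c % g).natDegree hx0
    have := pow_ne_zero k hx0
    field_simp
    ring
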